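/- The fourth derivative of d is strictly positive throughout the interval [5, 5.13]: d^{(4)}(t) > 0 for all t with 5 ≤ t ≤ 5.13. -/

import Mathlib

open MeasureTheory

/-- `G₊(x) = |1 + e(x) + e(7x)|² = 3 + 2(cos 2πx + cos 12πx + cos 14πx)`. -/
noncomputable def Gp (x : ℝ) : ℝ :=
  3 + 2 * (Real.cos (2 * Real.pi * x) + Real.cos (12 * Real.pi * x) + Real.cos (14 * Real.pi * x))

/-- `G₋(x) = |1 + e(x) − e(7x)|² = 3 + 2(cos 2πx − cos 12πx − cos 14πx)`. -/
noncomputable def Gm (x : ℝ) : ℝ :=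
  3 + 2 * (Real.cos (2 * Real.pi * x) - Real.cos (12 * Real.pi * x) - Real.cos (14 * Real.pi * x))

/-- `d(t) = ∫₀^{1/2} (G₋ᵗ − G₊ᵗ)`, real powers (`0^t = 0` for `t ≠ 0`). -/
noncomputable def d (t : ℝ) : ℝ := ∫ x in (0:ℝ)..(1/2), (Gm x ^ t - Gp x ^ t)

/-! ### Integer lists as polynomials and as cosine sums -/

/-- Coefficientwise sum of two coefficient lists. -/
def listAdd : List ℤ → List ℤ → List ℤ
  | [], m => m
  | a :: l, [] => a :: l
  | a :: l, b :: m => (a + b) :: listAdd l m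

/-- Scalar multiple of a coefficient list. -/
def listSmul (c : ℤ) : List ℤ → List ℤ
  | [] => []
  | a :: l => c * a :: listSmul c l

/-- Shift of a coefficient list by `n` places. -/
def listShift : ℕ → List ℤ → List ℤ
  | 0, l => l
  | n + 1, l => 0 :: listShift n l

/-- The sum `∑ i, lᵢ cos (2π (s + i) x)`. -/
noncomputable def cosSum : List ℤ → ℤ → ℝ → ℝ
  | [], _, _ => 0
  | a :: l, s, x => a * Real.cos (2 * Real.pi * s * x) + cosSum l (s + 1) x

theorem cosSum_listAdd (l m : List ℤ) (s : ℤ) (x : ℝ) :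
    cosSum (listAdd l m) s x = cosSum l s x + cosSum m s x := by
  induction l generalizing m s with
  | nil => simp [listAdd, cosSum]
  | cons a l ih =>
    cases m with
    | nil => simp [listAdd, cosSum]
    | cons b m =>
      simp only [listAdd, cosSum, ih]
      push_cast
      ring

theorem cosSum_listSmul (c : ℤ) (l : List ℤ) (s : ℤ) (x : ℝ) :
    cosSum (listSmul c l) s x = c * cosSum l s x := by
  induction l generalizing s with
  | nil => simp [listSmul, cosSum]
  | cons a l ih =>
    simp only [listSmul, cosSum, ih]
    push_cast
    ring

theorem cosSum_listShift (n : ℕ) (l : List ℤ) (s : ℤ) (x : ℝ) :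
    cosSum (listShift n l) s x = cosSum l (s + n) x := by
  induction n generalizing s with
  | zero => simp [listShift]
  | succ n ih =>
    simp only [listShift, cosSum, ih]
    push_cast
    rw [show s + 1 + (n : ℤ) = s + (n + 1) by ring]
    ring

theorem two_mul_cos_mul_cosSum (j : ℤ) (l : List ℤ) (s : ℤ) (x : ℝ) :
    2 * Real.cos (2 * Real.pi * j * x) * cosSum l s x =
      cosSum l (s + j) x + cosSum l (s - j) x := by
  induction l generalizing s with
  | nil => simp [cosSum]
  | cons a l ih =>
    have h : 2 * Real.cos (2 * Real.pi * j * x) * Real.cos (2 * Real.pi * s * x) =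
        Real.cos (2 * Real.pi * (s + j) * x) + Real.cos (2 * Real.pi * (s - j) * x) := by
      rw [show 2 * Real.pi * (s + j) * x = 2 * Real.pi * s * x + 2 * Real.pi * j * x by ring,
        show 2 * Real.pi * (s - j) * x = 2 * Real.pi * s * x - 2 * Real.pi * j * x by ring,
        Real.cos_add, Real.cos_sub]
      ring
    have h' := ih (s + 1)
    rw [show s + 1 + j = s + j + 1 by ring, show s + 1 - j = s - j + 1 by ring] at h'
    simp only [cosSum]
    push_cast
    linear_combination (a : ℝ) * h + h'

theorem continuous_cosSum (l : List ℤ) (s : ℤ) : Continuous (cosSum l s) := by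
  induction l generalizing s with
  | nil => exact continuous_const
  | cons a l ih =>
    have := ih (s + 1)
    change Continuous fun x => (a : ℝ) * Real.cos (2 * Real.pi * s * x) + cosSum l (s + 1) x
    fun_prop

theorem integral_cos_half (s : ℤ) (hs : s ≠ 0) :
    ∫ x in (0:ℝ)..(1/2), Real.cos (2 * Real.pi * s * x) = 0 := by
  have hc : 2 * Real.pi * (s : ℝ) ≠ 0 := by
    have : (s : ℝ) ≠ 0 := by exact_mod_cast hs
    positivity
  rw [intervalIntegral.integral_comp_mul_left _ hc, integral_cos,
    show 2 * Real.pi * (s : ℝ) * (1 / 2) = s * Real.pi by ring, Real.sin_int_mul_pi]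
  simp

theorem integral_cosSum_cons (a : ℤ) (l : List ℤ) (s : ℤ) :
    ∫ x in (0:ℝ)..(1/2), cosSum (a :: l) s x =
      a * (∫ x in (0:ℝ)..(1/2), Real.cos (2 * Real.pi * s * x)) +
        ∫ x in (0:ℝ)..(1/2), cosSum l (s + 1) x := by
  simp only [cosSum]
  rw [intervalIntegral.integral_add, intervalIntegral.integral_const_mul]
  · exact Continuous.intervalIntegrable (by fun_prop) _ _
  · exact (continuous_cosSum l _).intervalIntegrable _ _

theorem integral_cosSum_pos (l : List ℤ) (s : ℤ) (hs : 0 < s) :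
    ∫ x in (0:ℝ)..(1/2), cosSum l s x = 0 := by
  induction l generalizing s with
  | nil => simp [cosSum]
  | cons a l ih => rw [integral_cosSum_cons, integral_cos_half s hs.ne', ih _ (by lia)]; simp

theorem integral_cosSum (l : List ℤ) (m : ℕ) :
    ∫ x in (0:ℝ)..(1/2), cosSum l (-(m : ℤ)) x = ((l.getD m 0 : ℤ) : ℝ) / 2 := by
  induction l generalizing m with
  | nil => simp [cosSum]
  | cons a l ih =>
    rw [integral_cosSum_cons]
    cases m with
    | zero =>
      rw [integral_cosSum_pos _ _ (by simp)]
      simp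
      ring
    | succ m =>
      rw [integral_cos_half _ (by lia), show -((m + 1 : ℕ) : ℤ) + 1 = -(m : ℤ) by push_cast; ring,
        ih]
      simp

/-! ### Moments of `2 G - 9` -/

/-- `2 G₊ - 9` for `e = 1` and `2 G₋ - 9` for `e = -1`. -/
noncomputable def shiftedG (e : ℤ) (x : ℝ) : ℝ :=
  -3 + 4 * (Real.cos (2 * Real.pi * x) +
    e * (Real.cos (12 * Real.pi * x) + Real.cos (14 * Real.pi * x)))

/-- Multiplication by `shiftedG e` in terms of coefficient lists, up to a shift by `7`. -/
def stencil (e : ℤ) (l : List ℤ) : List ℤ :=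
  listAdd
    (listSmul (2 * e) (listAdd (listAdd l (listShift 1 l))
      (listAdd (listShift 13 l) (listShift 14 l))))
    (listShift 6 (listAdd (listSmul 2 (listAdd l (listShift 2 l)))
      (listShift 1 (listSmul (-3) l))))

theorem shiftedG_mul_cosSum (e : ℤ) (l : List ℤ) (s : ℤ) (x : ℝ) :
    shiftedG e x * cosSum l s x = cosSum (stencil e l) (s - 7) x := by
  have h1 := two_mul_cos_mul_cosSum 1 l s x
  have h6 := two_mul_cos_mul_cosSum 6 l s x
  have h7 := two_mul_cos_mul_cosSum 7 l s x
  simp only [stencil, cosSum_listAdd, cosSum_listSmul, cosSum_listShift]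
  push_cast at *
  rw [show s - 7 + 1 = s - 6 by ring, show s - 7 + 13 = s + 6 by ring,
    show s - 7 + 14 = s + 7 by ring, show s - 7 + 6 = s - 1 by ring,
    show s - 1 + 2 = s + 1 by ring, show s - 1 + 1 = s by ring]
  rw [show 2 * Real.pi * 1 * x = 2 * Real.pi * x by ring] at h1
  rw [show 2 * Real.pi * 6 * x = 12 * Real.pi * x by ring] at h6
  rw [show 2 * Real.pi * 7 * x = 14 * Real.pi * x by ring] at h7
  rw [shiftedG]
  linear_combination 2 * h1 + 2 * e * h6 + 2 * e * h7

/-- Coefficients of the powers of `shiftedG e`. -/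
def powerList (e : ℤ) : ℕ → List ℤ
  | 0 => [1]
  | k + 1 => stencil e (powerList e k)

theorem shiftedG_pow (e : ℤ) (k : ℕ) (x : ℝ) :
    shiftedG e x ^ k = cosSum (powerList e k) (-((7 * k : ℕ) : ℤ)) x := by
  induction k with
  | zero => simp [powerList, cosSum]
  | succ k ih =>
    rw [pow_succ', ih, shiftedG_mul_cosSum, powerList]
    congr 1
    push_cast
    ring

/-- The constant term of the `k`-th power of `shiftedG e`. -/
def constTerm (e : ℤ) (k : ℕ) : ℤ := (powerList e k).getD (7 * k) 0

theorem integral_shiftedG_pow (e : ℤ) (k : ℕ) :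
    ∫ x in (0:ℝ)..(1/2), shiftedG e x ^ k = (constTerm e k : ℝ) / 2 := by
  simp_rw [shiftedG_pow]
  exact integral_cosSum _ _

/-- The central entries of `l`, `stencil e l`, `stencil e (stencil e l)`, …, starting with the
entry of index `m` in `l`. -/
def centralEntries (e : ℤ) : ℕ → ℕ → List ℤ → List ℤ
  | 0, _, _ => []
  | n + 1, m, l => l.getD m 0 :: centralEntries e n (m + 7) (stencil e l)

theorem getD_centralEntries (e : ℤ) (n k i : ℕ) (hi : i < n) :
    (centralEntries e n (7 * k) (powerList e k)).getD i 0 = constTerm e (k + i) := by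
  induction n generalizing k i with
  | zero => lia
  | succ n ih =>
    cases i with
    | zero => simp [centralEntries, constTerm]
    | succ i =>
      rw [centralEntries, List.getD_cons_succ, show 7 * k + 7 = 7 * (k + 1) by ring,
        ← powerList, ih (k + 1) i (by lia)]
      congr 1
      ring

/-- The constant terms of the powers of `2 G₊ - 9` up to exponent `44`. -/
def plusTerms : List ℤ :=
  [1, -3, 33, -147, 1665, -8163, 95649, -485747, 5950465, -30373059, 390865953, -1970304339,
   26666259585, -131346459299, 1868593672097, -8934177140787, 133481505448961, -616811985186179,
   9671279827516449, -43055248183354899, 708300026352139905, -3029892024835287395,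
   52312098218883657121, -214497762160821150451, 3889794367714781227009,
   -15251075173898113092163, 290858541762696873977889, -1087678605250051952358099,
   21852175725336395647952001, -77726154092890560013057059, 1648484081275439908457713569,
   -5560477787272311958748783027, 124806070661994834064665114625,
   -397913071530062535948665678595, 9479306585790930280982906816545,
   -28462179887546494242206147296147, 722053078349695685528098402002561,
   -2033418245366251315107231606407907, 55144135800300479427232654199190945,
   -144985336009831306777076165749574771, 4221544718426226470243232133496648705,
   -10308336241873549333184815910860599235, 323894469768227840114369771927502322721,
   -730123675024970058129938780882437464147, 24901472115985419645211085656585847301249]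

/-- The constant terms of the powers of `2 G₋ - 9` up to exponent `44`. -/
def minusTerms : List ℤ :=
  [1, -3, 33, -147, 1665, -8163, 95649, -489331, 5856257, -30944451, 373847073, -2040422739,
   24642929793, -139248222883, 1667963674529, -9778685262387, 115468258165761, -703127652023683,
   8149874191653921, -51541541030673939, 584905165400219265, -3837201658388920675,
   42584112174794427809, -289220529308191516915, 3138647762924839327745,
   -22012591563019675767363, 233769542735917700601889, -1688237516188321822504659,
   17567295739661894310638721, -130256602356149025276519459, 1330178805518213338308337569,
   -10097430891074504844393800627, 101369126117484232068842797057,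
   -785660224949325867091247991555, 7767308900845917800545942964257,
   -61311081567976013586414412753811, 597929089801124706048495097357953,
   -4795883971094406876807224494138083, 46210974247731275835565169876383137,
   -375862198359711975413535296987368051, 3583500722985672312403173095657604097,
   -29503214830753341526019508548777183171, 278694388963894749821141020513284525089,
   -2318867167453154196842346235585239546963, 21728657611923037786907478987382865171585]

theorem centralEntries_plus : centralEntries 1 45 0 [1] = plusTerms := by decide +kernel

theorem centralEntries_minus : centralEntries (-1) 45 0 [1] = minusTerms := by decide +kernel

theorem constTerm_one (k : ℕ) (hk : k < 45) : constTerm 1 k = plusTerms.getD k 0 := by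
  have h := getD_centralEntries 1 45 0 k hk
  rwa [mul_zero, powerList, centralEntries_plus, zero_add, eq_comm] at h

theorem constTerm_neg_one (k : ℕ) (hk : k < 45) :
    constTerm (-1) k = minusTerms.getD k 0 := by
  have h := getD_centralEntries (-1) 45 0 k hk
  rwa [mul_zero, powerList, centralEntries_minus, zero_add, eq_comm] at h

/-! ### Twisted derivatives of polynomials -/

section Twist

open Polynomial

/-- The operator `p ↦ p' + c p`, which is differentiation conjugated by `exp (c τ)`. -/
noncomputable def twist (c : ℝ) : Module.End ℝ ℝ[X] := derivative + c • LinearMap.id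

theorem twist_apply (c : ℝ) (p : ℝ[X]) : twist c p = derivative p + c • p := rfl

theorem hasDerivAt_rpow_mul_eval {b : ℝ} (hb : 0 < b) (a : ℝ) (p : ℝ[X]) (t : ℝ) :
    HasDerivAt (fun t => b ^ t * p.eval (t - a))
      (b ^ t * (twist (Real.log b) p).eval (t - a)) t := by
  have h1 : HasDerivAt (fun t => b ^ t) (b ^ t * Real.log b) t :=
    (Real.hasStrictDerivAt_const_rpow hb t).hasDerivAt
  have h2 : HasDerivAt (fun t => p.eval (t - a)) (p.derivative.eval (t - a)) t := by
    simpa using (p.hasDerivAt (t - a)).comp_sub_const t a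
  convert! h1.mul h2 using 1
  simp [twist_apply]
  ring

/-- The polynomial `s + v X`. -/
noncomputable def linPoly (s v : ℝ) : ℝ[X] := C s + C v * X

theorem twist_linPoly_mul (c s v : ℝ) (p : ℝ[X]) :
    twist c (linPoly s v * p) = linPoly s v * twist c p + v • p := by
  simp only [twist_apply, linPoly, derivative_mul, derivative_add, derivative_C, derivative_X,
    smul_eq_C_mul]
  ring

theorem twist_pow_linPoly_mul (c s v : ℝ) (p : ℝ[X]) (j : ℕ) :
    (twist c ^ (j + 1)) (linPoly s v * p) =
      linPoly s v * (twist c ^ (j + 1)) p + ((j + 1) * v) • (twist c ^ j) p := by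
  induction j with
  | zero => simp [twist_linPoly_mul]
  | succ j ih =>
    rw [pow_succ', Module.End.mul_apply, ih, map_add, map_smul, twist_linPoly_mul,
      ← Module.End.mul_apply, ← pow_succ', ← Module.End.mul_apply, ← pow_succ', add_assoc,
      ← add_smul]
    push_cast
    ring_nf

theorem twist_pow_one (c : ℝ) (j : ℕ) : (twist c ^ j) 1 = C (c ^ j) := by
  induction j with
  | zero => simp
  | succ j ih =>
    rw [pow_succ', Module.End.mul_apply, ih, twist_apply, derivative_C, smul_C, zero_add,
      smul_eq_mul, ← pow_succ']

theorem pow_succ_add_le_add_pow {h x : ℝ} (hh : 0 ≤ h) (hx : 0 ≤ x) (j : ℕ) :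
    h ^ (j + 1) + (j + 1) * h ^ j * x ≤ (h + x) ^ (j + 1) := by
  induction j with
  | zero => simp
  | succ j ih =>
    have h1 := mul_le_mul_of_nonneg_right ih (add_nonneg hh hx)
    rw [← pow_succ] at h1
    refine le_trans ?_ h1
    have h2 : 0 ≤ (j + 1) * h ^ j * x ^ 2 := by positivity
    push_cast
    linear_combination h2

/-- Multiplication by a linear factor `s + v X` increases the growth rate of the twisted
derivatives by at most `1 / s`. -/
theorem abs_eval_twist_pow_linPoly_mul_le {c τ a h s v b : ℝ} {p : ℝ[X]} (ha : 0 ≤ a)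
    (hh : 0 ≤ h) (hs : 0 < s) (hv : |v| ≤ 1) (hsb : s ≤ b) (hb : |s + v * τ| ≤ b)
    (hp : ∀ j, |((twist c ^ j) p).eval τ| ≤ a * h ^ j) (j : ℕ) :
    |((twist c ^ j) (linPoly s v * p)).eval τ| ≤ b * a * (h + 1 / s) ^ j := by
  have hlin : (linPoly s v).eval τ = s + v * τ := by simp [linPoly]
  have hb0 : 0 ≤ b := hs.le.trans hsb
  have key (j : ℕ) : |((linPoly s v) * (twist c ^ j) p).eval τ| ≤ b * (a * h ^ j) := by
    rw [eval_mul, hlin, abs_mul]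
    exact mul_le_mul hb (hp j) (abs_nonneg _) hb0
  cases j with
  | zero => simpa [mul_assoc] using key 0
  | succ j =>
    rw [twist_pow_linPoly_mul, eval_add, eval_smul, smul_eq_mul]
    refine (abs_add_le _ _).trans ?_
    have h1 : |(j + 1) * v * ((twist c ^ j) p).eval τ| ≤ (j + 1) * (a * h ^ j) := by
      rw [abs_mul, abs_mul, abs_of_nonneg (by positivity : (0:ℝ) ≤ j + 1)]
      refine mul_le_mul ?_ (hp j) (abs_nonneg _) (by positivity)
      exact mul_le_of_le_one_right (by positivity) hv
    have h2 : (j + 1) * (a * h ^ j) ≤ b * a * ((j + 1) * h ^ j * (1 / s)) := by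
      have h3 : 1 ≤ b / s := (one_le_div hs).2 hsb
      calc (j + 1) * (a * h ^ j) ≤ (j + 1) * (a * h ^ j) * (b / s) :=
            le_mul_of_one_le_right (by positivity) h3
        _ = _ := by ring
    have h4 := mul_le_mul_of_nonneg_left
      (pow_succ_add_le_add_pow hh (one_div_pos.2 hs).le j) (mul_nonneg hb0 ha)
    linarith [key (j + 1)]

/-- The polynomial `(X + 1) ⋯ (X + 5) (1 - X) ⋯ (n - X)`. -/
noncomputable def binPoly : ℕ → ℝ[X]
  | 0 => linPoly 5 1 * (linPoly 4 1 * (linPoly 3 1 * (linPoly 2 1 * (linPoly 1 1 * 1))))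
  | n + 1 => linPoly (n + 1) (-1) * binPoly n

/-- The growth rate of the twisted derivatives of `binPoly n`. -/
noncomputable def growthRate (c : ℝ) (n : ℕ) : ℝ :=
  c + 137 / 60 + ∑ i ∈ Finset.range n, 1 / ((i : ℝ) + 1)

theorem growthRate_succ (c : ℝ) (n : ℕ) :
    growthRate c (n + 1) = growthRate c n + 1 / ((n : ℝ) + 1) := by
  simp only [growthRate, Finset.sum_range_succ]
  ring

theorem le_growthRate (c : ℝ) (n : ℕ) : c + 137 / 60 ≤ growthRate c n :=
  le_add_of_nonneg_right (Finset.sum_nonneg fun _ _ => by positivity)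

theorem abs_eval_twist_pow_binPoly_zero_le {c r τ : ℝ} (hc : 0 ≤ c) (hτ : |τ| ≤ r) (j : ℕ) :
    |((twist c ^ j) (binPoly 0)).eval τ| ≤
      (5 + r) * ((4 + r) * ((3 + r) * ((2 + r) * (1 + r)))) * growthRate c 0 ^ j := by
  have hr : 0 ≤ r := (abs_nonneg τ).trans hτ
  have hfac (s : ℝ) (hs : 0 < s) : |s + 1 * τ| ≤ s + r := by
    rw [one_mul]
    exact (abs_add_le _ _).trans (add_le_add (abs_of_pos hs).le hτ)
  have h0 (j : ℕ) : |((twist c ^ j) 1).eval τ| ≤ 1 * c ^ j := by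
    rw [twist_pow_one, eval_C, abs_of_nonneg (by positivity), one_mul]
  have step {p : ℝ[X]} {a h : ℝ} (s : ℝ) (hs : 0 < s) (ha : 0 ≤ a) (hh : 0 ≤ h)
      (hp : ∀ j, |((twist c ^ j) p).eval τ| ≤ a * h ^ j) (j : ℕ) :=
    abs_eval_twist_pow_linPoly_mul_le ha hh hs (by simp : |(1 : ℝ)| ≤ 1)
      (le_add_of_nonneg_right hr) (hfac s hs) hp j
  have h5 := step 5 (by norm_num) (by positivity) (by positivity) <|
    step 4 (by norm_num) (by positivity) (by positivity) <|
    step 3 (by norm_num) (by positivity) (by positivity) <|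
    step 2 (by norm_num) (by positivity) (by positivity) <|
    step 1 (by norm_num) (by positivity) hc h0
  have hg : growthRate c 0 = c + 1 / 1 + 1 / 2 + 1 / 3 + 1 / 4 + 1 / 5 := by
    simp only [growthRate, Finset.range_zero, Finset.sum_empty]
    ring
  rw [hg]
  exact (h5 j).trans_eq (by ring)

theorem abs_eval_twist_pow_binPoly_le_of_mem_Icc {c r τ : ℝ} (hc : 0 ≤ c) (hτ : 0 ≤ τ)
    (hτr : τ ≤ r) (hr : r ≤ 1) (n j : ℕ) :
    |((twist c ^ j) (binPoly n)).eval τ| ≤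
      n.factorial * ((5 + r) * ((4 + r) * ((3 + r) * ((2 + r) * (1 + r))))) *
        growthRate c n ^ j := by
  have hr0 : 0 ≤ r := hτ.trans hτr
  induction n generalizing j with
  | zero =>
    simpa using abs_eval_twist_pow_binPoly_zero_le hc (abs_le.2 ⟨by linarith, hτr⟩) j
  | succ n ih =>
    have hn : (0:ℝ) ≤ n := n.cast_nonneg
    have h := abs_eval_twist_pow_linPoly_mul_le (s := n + 1) (v := -1) (b := n + 1)
      (by positivity) (le_trans (by positivity) (le_growthRate c n)) (by positivity)
      (by simp) le_rfl (abs_le.2 ⟨by linarith, by linarith⟩) ih j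
    rw [binPoly, growthRate_succ, Nat.factorial_succ]
    convert h using 2
    push_cast
    ring

theorem abs_eval_twist_pow_binPoly_le {c τ : ℝ} (hc : 0 ≤ c) (hτ : |τ| ≤ 1) (n j : ℕ) :
    |((twist c ^ j) (binPoly n)).eval τ| ≤ (n + 1).factorial * 720 * growthRate c n ^ j := by
  induction n generalizing j with
  | zero =>
    convert abs_eval_twist_pow_binPoly_zero_le hc hτ j using 2
    norm_num
  | succ n ih =>
    have hn : (0:ℝ) ≤ n := n.cast_nonneg
    have hτ' := abs_le.1 hτ
    have h := abs_eval_twist_pow_linPoly_mul_le (s := n + 1) (v := -1) (b := n + 2)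
      (by positivity) (le_trans (by positivity) (le_growthRate c n)) (by positivity)
      (by simp) (by linarith) (abs_le.2 ⟨by linarith, by linarith⟩) ih j
    rw [binPoly, growthRate_succ, Nat.factorial_succ]
    convert h using 2
    push_cast
    ring

theorem eval_twist_pow_X_mul (c τ : ℝ) (p : ℝ[X]) (j : ℕ) :
    ((twist c ^ (j + 1)) (X * p)).eval τ =
      τ * ((twist c ^ (j + 1)) p).eval τ + (j + 1) * ((twist c ^ j) p).eval τ := by
  have h := twist_pow_linPoly_mul c 0 1 p j
  have hX : linPoly 0 1 = X := by simp [linPoly]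
  rw [hX] at h
  simp [h]

theorem abs_eval_twist_pow_X_mul_le {c τ a h : ℝ} {p : ℝ[X]} (ha : 0 ≤ a) (hh : 1 ≤ h)
    (hτ : |τ| ≤ 1) (hp : ∀ j, |((twist c ^ j) p).eval τ| ≤ a * h ^ j) {j : ℕ} (hj : j ≤ 4) :
    |((twist c ^ j) (X * p)).eval τ| ≤ 5 * a * h ^ 4 := by
  have hpow (i : ℕ) (hi : i ≤ 4) : |((twist c ^ i) p).eval τ| ≤ a * h ^ 4 :=
    (hp i).trans (mul_le_mul_of_nonneg_left (pow_le_pow_right₀ hh hi) ha)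
  have hτp (i : ℕ) (hi : i ≤ 4) : |τ * ((twist c ^ i) p).eval τ| ≤ a * h ^ 4 := by
    rw [abs_mul]
    exact (mul_le_of_le_one_left (abs_nonneg _) hτ).trans (hpow i hi)
  have h0 : 0 ≤ a * h ^ 4 := by positivity
  cases j with
  | zero =>
    have := hτp 0 (by simp)
    simp only [pow_zero, Module.End.one_apply, eval_mul, eval_X] at this ⊢
    linarith
  | succ j =>
    rw [eval_twist_pow_X_mul]
    refine (abs_add_le _ _).trans ?_
    have hj' : (j : ℝ) + 1 ≤ 4 := by exact_mod_cast hj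
    have h1 : |((j : ℝ) + 1) * ((twist c ^ j) p).eval τ| ≤ 4 * (a * h ^ 4) := by
      rw [abs_mul, abs_of_nonneg (by positivity : (0:ℝ) ≤ j + 1)]
      exact mul_le_mul hj' (hpow j (by lia)) (abs_nonneg _) (by norm_num)
    linarith [hτp _ hj]

/-! ### Integer lists as polynomials -/

/-- The polynomial with coefficient list `l`. -/
noncomputable def ofList : List ℤ → ℝ[X]
  | [] => 0
  | a :: l => C (a : ℝ) + X * ofList l

theorem ofList_listAdd (l m : List ℤ) : ofList (listAdd l m) = ofList l + ofList m := by
  induction l generalizing m with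
  | nil => simp [listAdd, ofList]
  | cons a l ih =>
    cases m with
    | nil => simp [listAdd, ofList]
    | cons b m =>
      simp only [listAdd, ofList, ih, Int.cast_add, C_add]
      ring

theorem ofList_listSmul (c : ℤ) (l : List ℤ) : ofList (listSmul c l) = C (c : ℝ) * ofList l := by
  induction l with
  | nil => simp [listSmul, ofList]
  | cons a l ih =>
    simp only [listSmul, ofList, ih, Int.cast_mul, C_mul]
    ring

theorem ofList_zero_cons (l : List ℤ) : ofList (0 :: l) = X * ofList l := by simp [ofList]

/-- The coefficient list of the derivative. -/
def listDeriv : List ℤ → List ℤ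
  | [] => []
  | _ :: l => listAdd l (0 :: listDeriv l)

theorem ofList_listDeriv (l : List ℤ) : ofList (listDeriv l) = derivative (ofList l) := by
  induction l with
  | nil => simp [listDeriv, ofList]
  | cons a l ih => simp [listDeriv, ofList, ofList_listAdd, ih]

/-- The coefficient list of `125 p' + 188 p`, that is, of `125` times `twist (188 / 125)`. -/
def listTwist (l : List ℤ) : List ℤ := listAdd (listSmul 125 (listDeriv l)) (listSmul 188 l)

theorem ofList_listTwist (l : List ℤ) :
    ofList (listTwist l) = (125 : ℝ) • twist (188 / 125) (ofList l) := by
  simp only [listTwist, ofList_listAdd, ofList_listSmul, ofList_listDeriv, twist_apply,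
    smul_add, smul_eq_C_mul, ← mul_assoc, ← C_mul]
  norm_num

/-- The lower bound `∑ i, min lᵢ 0 * r ^ i` for the values on `[0, r]`. -/
def negBound (r : ℚ) : List ℤ → ℚ
  | [] => 0
  | a :: l => min (a : ℚ) 0 + r * negBound r l

theorem negBound_nonpos {r : ℚ} (hr : 0 ≤ r) (l : List ℤ) : negBound r l ≤ 0 := by
  induction l with
  | nil => simp [negBound]
  | cons a l ih => exact add_nonpos (min_le_right _ _) (mul_nonpos_of_nonneg_of_nonpos hr ih)

theorem mul_negBound_le {r : ℚ} {τ : ℝ} (hr : 0 ≤ r) (hτ : 0 ≤ τ) (hτr : τ ≤ r) {l : List ℤ}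
    (h : (negBound r l : ℝ) ≤ (ofList l).eval τ) :
    (r : ℝ) * negBound r l ≤ τ * (ofList l).eval τ := by
  have h1 : (negBound r l : ℝ) ≤ 0 := by exact_mod_cast negBound_nonpos hr l
  nlinarith

theorem negBound_le_eval {r : ℚ} {τ : ℝ} (hr : 0 ≤ r) (hτ : 0 ≤ τ) (hτr : τ ≤ r) (l : List ℤ) :
    (negBound r l : ℝ) ≤ (ofList l).eval τ := by
  induction l with
  | nil => simp [negBound, ofList]
  | cons a l ih =>
    have h1 : ((min (a : ℚ) 0 : ℚ) : ℝ) ≤ a := by exact_mod_cast min_le_left (a : ℚ) 0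
    simp only [negBound, ofList, eval_add, eval_C, eval_mul, eval_X, Rat.cast_add, Rat.cast_mul]
    exact add_le_add h1 (mul_negBound_le hr hτ hτr ih)

/-- The lower bound `l₀ + ∑ i ≥ 1, min lᵢ 0 * r ^ i` for the values on `[0, r]`. -/
def lowerBound (r : ℚ) : List ℤ → ℚ
  | [] => 0
  | a :: l => a + r * negBound r l

theorem lowerBound_le_eval {r : ℚ} {τ : ℝ} (hr : 0 ≤ r) (hτ : 0 ≤ τ) (hτr : τ ≤ r)
    (l : List ℤ) : (lowerBound r l : ℝ) ≤ (ofList l).eval τ := by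
  cases l with
  | nil => simp [lowerBound, ofList]
  | cons a l =>
    simp only [lowerBound, ofList, eval_add, eval_C, eval_mul, eval_X, Rat.cast_add,
      Rat.cast_mul, Rat.cast_intCast]
    exact add_le_add le_rfl (mul_negBound_le hr hτ hτr (negBound_le_eval hr hτ hτr l))

/-- The coefficient list of `binPoly n`. -/
def binList : ℕ → List ℤ
  | 0 => [120, 274, 225, 85, 15, 1]
  | n + 1 => listAdd (listSmul (n + 1) (binList n)) (listSmul (-1) (0 :: binList n))

theorem ofList_binList (n : ℕ) : ofList (binList n) = binPoly n := by
  induction n with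
  | zero =>
    simp only [binList, binPoly, ofList, linPoly]
    simp only [map_ofNat, map_one, Int.cast_ofNat, Int.cast_one]
    ring
  | succ n ih =>
    simp only [binList, binPoly, ofList_listAdd, ofList_listSmul, ofList_zero_cons, ih, linPoly]
    push_cast
    simp only [C_add, C_neg, map_one]
    ring

end Twist

/-! ### Bounds for the moments -/

theorem Gp_eq (x : ℝ) : Gp x = 9 / 2 * (1 + shiftedG 1 x / 9) := by
  simp only [Gp, shiftedG]
  push_cast
  ring

theorem Gm_eq (x : ℝ) : Gm x = 9 / 2 * (1 + shiftedG (-1) x / 9) := by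
  simp only [Gm, shiftedG]
  push_cast
  ring

theorem continuous_shiftedG (e : ℤ) : Continuous (shiftedG e) := by
  unfold shiftedG
  fun_prop

theorem abs_shiftedG_div_le {e : ℤ} (he : e ^ 2 = 1) (x : ℝ) : |shiftedG e x / 9| ≤ 1 := by
  have he' : (e : ℝ) ^ 2 = 1 := by exact_mod_cast he
  have h12 : Real.cos (12 * Real.pi * x) =
      Real.cos (14 * Real.pi * x) * Real.cos (2 * Real.pi * x) +
        Real.sin (14 * Real.pi * x) * Real.sin (2 * Real.pi * x) := by
    rw [← Real.cos_sub]
    ring_nf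
  have h2 := Real.sin_sq_add_cos_sq (2 * Real.pi * x)
  have h14 := Real.sin_sq_add_cos_sq (14 * Real.pi * x)
  have hlow : shiftedG e x + 9 =
      2 * ((1 + Real.cos (2 * Real.pi * x) + e * Real.cos (14 * Real.pi * x)) ^ 2 +
        (Real.sin (2 * Real.pi * x) + e * Real.sin (14 * Real.pi * x)) ^ 2) := by
    rw [shiftedG, h12]
    linear_combination (-2) * h2 - 2 * (e : ℝ) ^ 2 * h14 - 2 * he'
  have hlow' : 0 ≤ shiftedG e x + 9 := by
    rw [hlow]
    positivity
  have hcos (y : ℝ) : e * Real.cos y ≤ 1 := by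
    nlinarith [Real.cos_sq_le_one y, sq_nonneg ((e : ℝ) - Real.cos y)]
  have hup : shiftedG e x ≤ 9 := by
    rw [shiftedG]
    linarith [Real.cos_le_one (2 * Real.pi * x), hcos (12 * Real.pi * x),
      hcos (14 * Real.pi * x)]
  rw [abs_le]
  constructor <;> linarith

theorem integral_shiftedG_div_pow (e : ℤ) (k : ℕ) :
    ∫ x in (0:ℝ)..(1/2), (shiftedG e x / 9) ^ k = (constTerm e k : ℝ) / (2 * 9 ^ k) := by
  simp_rw [div_pow]
  rw [intervalIntegral.integral_div, integral_shiftedG_pow, div_div]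

theorem intervalIntegrable_shiftedG_div_pow (e : ℤ) (k : ℕ) :
    IntervalIntegrable (fun x => (shiftedG e x / 9) ^ k) volume 0 (1 / 2) := by
  have := continuous_shiftedG e
  exact Continuous.intervalIntegrable (by fun_prop) _ _

theorem abs_constTerm_div_le {e : ℤ} (he : e ^ 2 = 1) {m k : ℕ} (hm : Even m) (hmk : m ≤ k) :
    |(constTerm e k : ℝ) / (2 * 9 ^ k)| ≤ constTerm e m / (2 * 9 ^ m) := by
  rw [← integral_shiftedG_div_pow, ← integral_shiftedG_div_pow]
  rw [← Real.norm_eq_abs]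
  refine intervalIntegral.norm_integral_le_of_norm_le (by norm_num) (.of_forall fun x _ => ?_)
    (intervalIntegrable_shiftedG_div_pow e m)
  rw [Real.norm_eq_abs, abs_pow, ← hm.pow_abs]
  exact pow_le_pow_of_le_one (abs_nonneg _) (abs_shiftedG_div_le he x) hmk

/-- The difference of the `k`-th moments of `(2 G₋ - 9) / 9` and `(2 G₊ - 9) / 9`. -/
noncomputable def momentDiff (k : ℕ) : ℝ :=
  (constTerm (-1) k : ℝ) / (2 * 9 ^ k) - (constTerm 1 k : ℝ) / (2 * 9 ^ k)

theorem momentDiff_eq_integral (k : ℕ) :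
    momentDiff k = ∫ x in (0:ℝ)..(1/2),
      ((shiftedG (-1) x / 9) ^ k - (shiftedG 1 x / 9) ^ k) := by
  rw [intervalIntegral.integral_sub (intervalIntegrable_shiftedG_div_pow _ _)
    (intervalIntegrable_shiftedG_div_pow _ _), integral_shiftedG_div_pow,
    integral_shiftedG_div_pow, momentDiff]

theorem abs_momentDiff_le {m k : ℕ} (hm : Even m) (hmk : m ≤ k) :
    |momentDiff k| ≤
      (constTerm (-1) m : ℝ) / (2 * 9 ^ m) + (constTerm 1 m : ℝ) / (2 * 9 ^ m) :=
  (abs_sub _ _).trans (add_le_add (abs_constTerm_div_le (by norm_num) hm hmk)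
    (abs_constTerm_div_le (by norm_num) hm hmk))

theorem abs_momentDiff_le_one (k : ℕ) : |momentDiff k| ≤ 1 := by
  refine (abs_momentDiff_le Even.zero k.zero_le).trans_eq ?_
  norm_num [constTerm, powerList]

/-- The difference of the constant terms, looked up in the tables. -/
def tableDiff (k : ℕ) : ℤ := minusTerms.getD k 0 - plusTerms.getD k 0

theorem momentDiff_eq_tableDiff {k : ℕ} (hk : k < 45) :
    momentDiff k = (tableDiff k : ℝ) / (2 * 9 ^ k) := by
  rw [momentDiff, constTerm_one k hk, constTerm_neg_one k hk, tableDiff]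
  push_cast
  ring

theorem momentDiff_eq_zero {k : ℕ} (hk : k < 6) : momentDiff k = 0 := by
  rw [momentDiff_eq_tableDiff (by lia)]
  have : tableDiff k = 0 := by
    revert k
    decide +kernel
  simp [this]

theorem abs_momentDiff_le_of_le {k : ℕ} (hk : 44 ≤ k) : |momentDiff k| ≤ 1 / 40 := by
  refine (abs_momentDiff_le (m := 44) (by decide) hk).trans ?_
  have h : 40 * (minusTerms.getD 44 0 + plusTerms.getD 44 0) ≤ 2 * 9 ^ 44 := by decide +kernel
  rw [constTerm_one 44 (by simp), constTerm_neg_one 44 (by simp), ← add_div,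
    div_le_div_iff₀ (by positivity) (by norm_num)]
  have h' : (40 : ℝ) * ((minusTerms.getD 44 0 : ℤ) + (plusTerms.getD 44 0 : ℤ)) ≤ 2 * 9 ^ 44 := by
    exact_mod_cast h
  linarith

/-! ### Logarithm and growth rate -/

theorem le_log_nine_halves : 188 / 125 ≤ Real.log (9 / 2) := by
  rw [Real.le_log_iff_exp_le (by norm_num)]
  refine le_of_pow_le_pow_left₀ (n := 125) (by norm_num) (by norm_num) ?_
  rw [← Real.exp_nat_mul, show ((125 : ℕ) : ℝ) * (188 / 125) = (188 : ℕ) * 1 by norm_num,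
    Real.exp_nat_mul]
  refine (pow_le_pow_left₀ (Real.exp_pos 1).le Real.exp_one_lt_d9.le _).trans ?_
  norm_num

theorem log_nine_halves_le : Real.log (9 / 2) ≤ 151 / 100 := by
  rw [Real.log_le_iff_le_exp (by norm_num)]
  refine le_of_pow_le_pow_left₀ (n := 100) (by norm_num) (Real.exp_pos _).le ?_
  rw [← Real.exp_nat_mul, show ((100 : ℕ) : ℝ) * (151 / 100) = (151 : ℕ) * 1 by norm_num,
    Real.exp_nat_mul]
  refine le_trans ?_ (pow_le_pow_left₀ (by norm_num) Real.exp_one_gt_d9.le _)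
  norm_num

theorem growthRate_pow_four_le {n : ℕ} (hn : 39 ≤ n) :
    8 ≤ growthRate (Real.log (9 / 2)) n ∧
      growthRate (Real.log (9 / 2)) n ^ 4 ≤ 94 * (n + 6) := by
  induction n, hn using Nat.le_induction with
  | base =>
    have h1 := le_log_nine_halves
    have h2 := log_nine_halves_le
    have h3 : growthRate (Real.log (9 / 2)) 39 = Real.log (9 / 2) +
        (137 / 60 + 2066035355155033 / 485721041551200) := by
      rw [growthRate, add_assoc]
      norm_num [Finset.sum_range_succ]
    refine ⟨by linarith, ?_⟩
    calc growthRate (Real.log (9 / 2)) 39 ^ 4 ≤ 8.05 ^ 4 :=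
          pow_le_pow_left₀ (by linarith) (by linarith) 4
      _ ≤ _ := by norm_num
  | succ n hn ih =>
    obtain ⟨h8, h4⟩ := ih
    rw [growthRate_succ]
    set h := growthRate (Real.log (9 / 2)) n
    have hn' : (39 : ℝ) ≤ n := by exact_mod_cast hn
    have hpos : 0 < 1 / ((n : ℝ) + 1) := by positivity
    refine ⟨by linarith, ?_⟩
    set y := 1 / ((n : ℝ) + 1) with hy
    have hyn : y * (n + 1) = 1 := by rw [hy]; field_simp
    have hy' : y ≤ 1 / 40 := one_div_le_one_div_of_le (by norm_num) (by linarith)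
    have h9 : h + y ≤ h * (1 + y / 8) := by nlinarith
    have h10 : (1 + y / 8) ^ 4 ≤ 1 + 3 / 5 * y := by
      have : (1 + y / 8) ^ 4 = 1 + y * (1 / 2 + y * (3 / 32 + y * (1 / 128 + y / 4096))) := by ring
      rw [this]
      have : y * (3 / 32 + y * (1 / 128 + y / 4096)) ≤ 1 / 40 * 1 := by
        refine mul_le_mul hy' ?_ (by positivity) (by norm_num)
        nlinarith
      nlinarith
    calc (h + y) ^ 4 ≤ (h * (1 + y / 8)) ^ 4 := pow_le_pow_left₀ (by positivity) h9 4
      _ = h ^ 4 * (1 + y / 8) ^ 4 := mul_pow _ _ _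
      _ ≤ 94 * (n + 6) * (1 + 3 / 5 * y) := mul_le_mul h4 h10 (by positivity) (by positivity)
      _ ≤ 94 * ((n + 1 : ℕ) + 6) := by
        push_cast
        nlinarith

/-! ### The binomial series -/

section Series

open Polynomial

theorem choose_add_six (τ : ℝ) (n : ℕ) :
    Ring.choose (5 + τ) (n + 6) =
      (-1) ^ n / ((n + 6).factorial : ℝ) * (X * binPoly n).eval τ := by
  have h (n : ℕ) : aeval (5 + τ) (descPochhammer ℤ (n + 6)) =
      (-1) ^ n * (X * binPoly n).eval τ := by
    induction n with
    | zero =>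
      simp only [descPochhammer_succ_right, descPochhammer_zero, binPoly, linPoly, map_mul,
        map_sub, map_natCast, map_one, aeval_X]
      simp
      ring
    | succ n ih =>
      rw [show n + 1 + 6 = n + 6 + 1 by ring, descPochhammer_succ_right, map_mul, ih, map_sub,
        map_natCast, aeval_X]
      simp [binPoly, linPoly]
      ring
  rw [Ring.choose_eq_smul, ← aeval_eq_smeval, h, smul_eq_mul]
  ring

/-- A summable bound for the twisted derivatives of `X * binPoly n` divided by `(n + 6)!`. -/
noncomputable def termBound (n : ℕ) : ℝ :=
  5 * ((n + 1).factorial * 720) * growthRate (Real.log (9 / 2)) n ^ 4 / (n + 6).factorial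

theorem factorial_add_six (n : ℕ) : ((n + 6).factorial : ℝ) =
    (n + 6) * ((n + 5) * (n + 4) * (n + 3) * (n + 2)) * (n + 1).factorial := by
  simp only [Nat.factorial_succ]
  push_cast
  ring

theorem termBound_nonneg (n : ℕ) : 0 ≤ termBound n := by
  unfold termBound
  positivity

theorem summable_termBound : Summable termBound := by
  refine Summable.of_norm_bounded_eventually_nat
    ((Real.summable_one_div_nat_pow (p := 2)).2 (by norm_num) |>.mul_left (3600 * 94)) ?_
  filter_upwards [Filter.eventually_ge_atTop 39] with n hn
  rw [Real.norm_eq_abs, abs_of_nonneg (termBound_nonneg n), termBound, factorial_add_six]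
  have hn' : (39 : ℝ) ≤ n := by exact_mod_cast hn
  have hf : (0 : ℝ) < (n + 1).factorial := by positivity
  have h1 : (n : ℝ) ^ 2 ≤ (n + 5) * (n + 4) * (n + 3) * (n + 2) := by
    have : (0 : ℝ) ≤ n := by linarith
    calc (n : ℝ) ^ 2 = n * n * 1 * 1 := by ring
      _ ≤ _ := by gcongr <;> linarith
  rw [mul_one_div, div_le_div_iff₀ (by positivity) (by positivity)]
  calc 5 * (((n + 1).factorial : ℝ) * 720) * growthRate (Real.log (9 / 2)) n ^ 4 * (n : ℝ) ^ 2
      ≤ 5 * (((n + 1).factorial : ℝ) * 720) * (94 * (n + 6)) *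
          ((n + 5) * (n + 4) * (n + 3) * (n + 2)) := by
        gcongr
        exact (growthRate_pow_four_le hn).2
    _ = _ := by ring

theorem one_le_log_nine_halves : 1 ≤ Real.log (9 / 2) :=
  le_trans (by norm_num) le_log_nine_halves

theorem abs_eval_twist_pow_X_mul_binPoly_le {τ : ℝ} (hτ : |τ| ≤ 1) (n : ℕ) {j : ℕ} (hj : j ≤ 4) :
    |((twist (Real.log (9 / 2)) ^ j) (X * binPoly n)).eval τ| / (n + 6).factorial ≤
      termBound n := by
  have h1 := one_le_log_nine_halves
  refine div_le_div_of_nonneg_right ?_ (by positivity)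
  exact abs_eval_twist_pow_X_mul_le (by positivity)
    (le_trans (by linarith) (le_growthRate _ n)) hτ
    (abs_eval_twist_pow_binPoly_le (by linarith) hτ n) hj

theorem abs_choose_add_six_le {t : ℝ} (ht : |t - 5| ≤ 1) (n : ℕ) :
    |Ring.choose t (n + 6)| ≤ termBound n := by
  have h := abs_eval_twist_pow_X_mul_binPoly_le ht n (Nat.zero_le 4)
  rw [show t = 5 + (t - 5) by ring, choose_add_six, abs_mul, abs_div, abs_pow, abs_neg, abs_one,
    one_pow, Nat.abs_cast, one_div_mul_eq_div]
  exact h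

theorem summable_abs_choose {t : ℝ} (ht : |t - 5| ≤ 1) :
    Summable fun k => |Ring.choose t k| :=
  (summable_nat_add_iff 6).1 <| summable_termBound.of_nonneg_of_le (fun _ => abs_nonneg _)
    (abs_choose_add_six_le ht)

theorem abs_choose_mul_pow_le (t : ℝ) {w : ℝ} (hw : |w| ≤ 1) (k : ℕ) :
    |Ring.choose t k * w ^ k| ≤ |Ring.choose t k| := by
  rw [abs_mul, abs_pow]
  exact mul_le_of_le_one_right (abs_nonneg _) (pow_le_one₀ (abs_nonneg _) hw)

theorem hasSum_choose_mul_pow {t w : ℝ} (ht : |t - 5| ≤ 1) (hw : |w| ≤ 1) :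
    HasSum (fun k => Ring.choose t k * w ^ k) ((1 + w) ^ t) := by
  have hbound (k : ℕ) (w : ℝ) (hw : w ∈ Set.Icc (-1 : ℝ) 1) :
      ‖Ring.choose t k * w ^ k‖ ≤ |Ring.choose t k| :=
    abs_choose_mul_pow_le t (abs_le.2 hw) k
  have ht0 : 0 ≤ t := by linarith [(abs_le.1 ht).1]
  have hopen : Set.EqOn (fun w : ℝ => (1 + w) ^ t) (fun w => ∑' k, Ring.choose t k * w ^ k)
      (Set.Ioo (-1) 1) := by
    intro w hw
    have h := (Real.one_add_rpow_hasFPowerSeriesOnBall_zero (a := t)).hasSum (y := w)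
      (by simpa [Metric.mem_eball, edist_dist] using abs_lt.2 hw)
    simp only [binomialSeries_apply, zero_add] at h
    simpa using h.tsum_eq.symm
  have heq : Set.EqOn (fun w : ℝ => (1 + w) ^ t) (fun w => ∑' k, Ring.choose t k * w ^ k)
      (Set.Icc (-1) 1) := by
    refine hopen.of_subset_closure ?_ ?_ Set.Ioo_subset_Icc_self ?_
    · exact ((continuous_const.add continuous_id).rpow_const fun _ => Or.inr ht0).continuousOn
    · exact continuousOn_tsum (fun k => by fun_prop) (summable_abs_choose ht) hbound
    · rw [closure_Ioo (by norm_num)]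
  have hs : Summable fun k => Ring.choose t k * w ^ k :=
    .of_norm_bounded (summable_abs_choose ht) fun k => hbound k w (abs_le.1 hw)
  rw [show (1 + w) ^ t = ∑' k, Ring.choose t k * w ^ k from heq (abs_le.1 hw)]
  exact hs.hasSum

/-- The polynomial part of the `n`-th term of the series for `d`. -/
noncomputable def termPoly (n : ℕ) : ℝ[X] :=
  ((-1) ^ n * momentDiff (n + 6) / (n + 6).factorial) • (X * binPoly n)

theorem d_eq_mul_integral {t : ℝ} :
    d t = (9 / 2) ^ t *
      ∫ x in (0:ℝ)..(1/2), ((1 + shiftedG (-1) x / 9) ^ t - (1 + shiftedG 1 x / 9) ^ t) := by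
  have h (e : ℤ) (he : e ^ 2 = 1) (x : ℝ) : 0 ≤ 1 + shiftedG e x / 9 := by
    linarith [(abs_le.1 (abs_shiftedG_div_le he x)).1]
  rw [d, ← intervalIntegral.integral_const_mul]
  refine intervalIntegral.integral_congr fun x _ => ?_
  rw [Gm_eq, Gp_eq, Real.mul_rpow (by norm_num) (h _ (by norm_num) x),
    Real.mul_rpow (by norm_num) (h _ (by norm_num) x), mul_sub]

theorem hasSum_choose_mul_momentDiff {t : ℝ} (ht : |t - 5| ≤ 1) :
    HasSum (fun k => Ring.choose t k * momentDiff k)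
      (∫ x in (0:ℝ)..(1/2),
        ((1 + shiftedG (-1) x / 9) ^ t - (1 + shiftedG 1 x / 9) ^ t)) := by
  have hint (k : ℕ) : Ring.choose t k * momentDiff k = ∫ x in (0:ℝ)..(1/2),
      (Ring.choose t k * (shiftedG (-1) x / 9) ^ k - Ring.choose t k * (shiftedG 1 x / 9) ^ k) := by
    simp_rw [momentDiff_eq_integral, ← intervalIntegral.integral_const_mul, mul_sub]
  simp_rw [hint]
  have hc (e : ℤ) := continuous_shiftedG e
  have hw (e : ℤ) (he : e ^ 2 = 1) (x : ℝ) := abs_shiftedG_div_le he x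
  refine intervalIntegral.hasSum_integral_of_dominated_convergence
    (fun k _ => 2 * |Ring.choose t k|) (fun k => ?_) (fun k => .of_forall fun x _ => ?_)
    (.of_forall fun x _ => (summable_abs_choose ht).mul_left 2) (by simp)
    (.of_forall fun x _ => ?_)
  · have h1 := hc 1
    have h2 := hc (-1)
    exact Continuous.aestronglyMeasurable (by fun_prop)
  · rw [Real.norm_eq_abs, two_mul]
    exact (abs_sub _ _).trans (add_le_add
      (abs_choose_mul_pow_le t (hw _ (by norm_num) x) k)
      (abs_choose_mul_pow_le t (hw _ (by norm_num) x) k))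
  · exact (hasSum_choose_mul_pow ht (hw _ (by norm_num) x)).sub
      (hasSum_choose_mul_pow ht (hw _ (by norm_num) x))

theorem eval_twist_pow_termPoly (c τ : ℝ) (n j : ℕ) :
    ((twist c ^ j) (termPoly n)).eval τ =
      (-1) ^ n * momentDiff (n + 6) / (n + 6).factorial *
        ((twist c ^ j) (X * binPoly n)).eval τ := by
  rw [termPoly, map_smul, eval_smul, smul_eq_mul]

theorem abs_eval_twist_pow_termPoly (c τ : ℝ) (n j : ℕ) :
    |((twist c ^ j) (termPoly n)).eval τ| =
      |momentDiff (n + 6)| *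
        (|((twist c ^ j) (X * binPoly n)).eval τ| / (n + 6).factorial) := by
  rw [eval_twist_pow_termPoly, abs_mul, abs_div, abs_mul, abs_pow, abs_neg, abs_one, one_pow,
    one_mul, Nat.abs_cast]
  ring

theorem abs_eval_twist_pow_termPoly_le {τ : ℝ} (hτ : |τ| ≤ 1) (n : ℕ) {j : ℕ} (hj : j ≤ 4) :
    |((twist (Real.log (9 / 2)) ^ j) (termPoly n)).eval τ| ≤ termBound n := by
  rw [abs_eval_twist_pow_termPoly]
  exact (mul_le_of_le_one_left (by positivity) (abs_momentDiff_le_one _)).trans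
    (abs_eval_twist_pow_X_mul_binPoly_le hτ n hj)

theorem d_eq_tsum {t : ℝ} (ht : |t - 5| ≤ 1) :
    d t = ∑' n, (9 / 2) ^ t * (termPoly n).eval (t - 5) := by
  rw [d_eq_mul_integral, tsum_mul_left]
  congr 1
  have h := (hasSum_nat_add_iff' 6).2 (hasSum_choose_mul_momentDiff ht)
  rw [Finset.sum_eq_zero fun k hk => by rw [momentDiff_eq_zero (Finset.mem_range.1 hk), mul_zero],
    sub_zero] at h
  rw [← h.tsum_eq]
  refine tsum_congr fun n => ?_
  have h2 := choose_add_six (t - 5) n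
  have h3 := eval_twist_pow_termPoly 0 (t - 5) n 0
  rw [add_sub_cancel] at h2
  simp only [pow_zero, Module.End.one_apply] at h3
  rw [h2, h3]
  ring

theorem iteratedDeriv_d {j : ℕ} (hj : j ≤ 4) {t : ℝ} (ht : t ∈ Set.Ioo (4 : ℝ) 6) :
    iteratedDeriv j d t = ∑' n, (9 / 2) ^ t *
      ((twist (Real.log (9 / 2)) ^ j) (termPoly n)).eval (t - 5) := by
  have habs {t : ℝ} (ht : t ∈ Set.Ioo (4 : ℝ) 6) : |t - 5| ≤ 1 :=
    abs_le.2 ⟨by linarith [ht.1], by linarith [ht.2]⟩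
  have hbound {j : ℕ} (hj : j ≤ 4) (n : ℕ) {t : ℝ} (ht : t ∈ Set.Ioo (4 : ℝ) 6) :
      ‖(9 / 2 : ℝ) ^ t * ((twist (Real.log (9 / 2)) ^ j) (termPoly n)).eval (t - 5)‖ ≤
        (9 / 2 : ℝ) ^ (6 : ℝ) * termBound n := by
    rw [norm_mul, Real.norm_eq_abs, Real.norm_eq_abs, abs_of_nonneg (by positivity)]
    exact mul_le_mul (Real.rpow_le_rpow_of_exponent_le (by norm_num) ht.2.le)
      (abs_eval_twist_pow_termPoly_le (habs ht) n hj) (abs_nonneg _) (by positivity)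
  have hsum := summable_termBound.mul_left ((9 / 2 : ℝ) ^ (6 : ℝ))
  induction j generalizing t with
  | zero => simpa using d_eq_tsum (habs ht)
  | succ j ih =>
    have hev : iteratedDeriv j d =ᶠ[nhds t] fun t => ∑' n, (9 / 2) ^ t *
        ((twist (Real.log (9 / 2)) ^ j) (termPoly n)).eval (t - 5) :=
      Filter.eventually_of_mem (isOpen_Ioo.mem_nhds ht) fun s hs => ih (by lia) hs
    rw [iteratedDeriv_succ, hev.deriv_eq]
    refine (hasDerivAt_tsum_of_isPreconnected hsum isOpen_Ioo isPreconnected_Ioo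
      (fun n s _ => ?_) (fun n s hs => hbound hj n hs) ht
      (.of_norm_bounded hsum fun n => hbound (by lia) n ht) ht).deriv
    have h := hasDerivAt_rpow_mul_eval (b := 9 / 2) (by norm_num) 5
      ((twist (Real.log (9 / 2)) ^ j) (termPoly n)) s
    rwa [← Module.End.mul_apply, ← pow_succ'] at h

end Series

/-! ### The partial sum -/

section PartialSum

open Polynomial

theorem twist_add (c θ : ℝ) (p : ℝ[X]) : twist (c + θ) p = twist c p + θ • p := by
  rw [twist_apply, twist_apply, add_smul, add_assoc]

theorem twist_add_pow_four (c θ : ℝ) (p : ℝ[X]) :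
    (twist (c + θ) ^ 4) p = (twist c ^ 4) p + (4 * θ) • (twist c ^ 3) p +
      (6 * θ ^ 2) • (twist c ^ 2) p + (4 * θ ^ 3) • (twist c ^ 1) p + θ ^ 4 • p := by
  simp only [pow_succ, pow_zero, one_mul, Module.End.mul_apply, twist_add, map_add, map_smul]
  module

theorem ofList_listTwist_iterate (l : List ℤ) (i : ℕ) :
    ofList (listTwist^[i] l) = (125 ^ i : ℝ) • (twist (188 / 125) ^ i) (ofList l) := by
  induction i with
  | zero => simp
  | succ i ih =>
    rw [Function.iterate_succ_apply', ofList_listTwist, ih, map_smul, smul_smul, ← pow_succ',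
      ← Module.End.mul_apply, ← pow_succ']

/-- A lower bound on `[0, r]` for the fourth twisted derivative of `ofList l`, valid for twists
between `188 / 125` and `188 / 125 + δ`. -/
def twistLowerBound (r δ : ℚ) (l : List ℤ) : ℚ :=
  lowerBound r (listTwist^[4] l) / 125 ^ 4 + 4 * δ * (negBound r (listTwist^[3] l) / 125 ^ 3) +
    6 * δ ^ 2 * (negBound r (listTwist^[2] l) / 125 ^ 2) +
    4 * δ ^ 3 * (negBound r (listTwist^[1] l) / 125 ^ 1) + δ ^ 4 * negBound r l

theorem twistLowerBound_le_eval {r δ : ℚ} {τ θ : ℝ} (hr : 0 ≤ r) (hτ : 0 ≤ τ) (hτr : τ ≤ r)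
    (hθ : 0 ≤ θ) (hθδ : θ ≤ δ) (l : List ℤ) :
    (twistLowerBound r δ l : ℝ) ≤ ((twist (188 / 125 + θ) ^ 4) (ofList l)).eval τ := by
  have heval (i : ℕ) : ((twist (188 / 125) ^ i) (ofList l)).eval τ =
      (ofList (listTwist^[i] l)).eval τ / 125 ^ i := by
    rw [ofList_listTwist_iterate, eval_smul, smul_eq_mul]
    field_simp
  have hneg (i j : ℕ) : δ ^ j * ((negBound r (listTwist^[i] l) : ℝ) / 125 ^ i) ≤
      θ ^ j * ((twist (188 / 125) ^ i) (ofList l)).eval τ := by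
    have h1 : (negBound r (listTwist^[i] l) : ℝ) / 125 ^ i ≤ 0 :=
      div_nonpos_of_nonpos_of_nonneg (by exact_mod_cast negBound_nonpos hr _) (by positivity)
    have h2 : (negBound r (listTwist^[i] l) : ℝ) / 125 ^ i ≤
        ((twist (188 / 125) ^ i) (ofList l)).eval τ := by
      rw [heval]
      exact div_le_div_of_nonneg_right (negBound_le_eval hr hτ hτr _) (by positivity)
    calc _ ≤ θ ^ j * ((negBound r (listTwist^[i] l) : ℝ) / 125 ^ i) :=
          mul_le_mul_of_nonpos_right (pow_le_pow_left₀ hθ hθδ j) h1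
      _ ≤ _ := mul_le_mul_of_nonneg_left h2 (by positivity)
  have h4 : (lowerBound r (listTwist^[4] l) : ℝ) / 125 ^ 4 ≤
      ((twist (188 / 125) ^ 4) (ofList l)).eval τ := by
    rw [heval]
    exact div_le_div_of_nonneg_right (lowerBound_le_eval hr hτ hτr _) (by positivity)
  have h3 := hneg 3 1
  have h2 := hneg 2 2
  have h1 := hneg 1 3
  have h0 := hneg 0 4
  rw [twist_add_pow_four, twistLowerBound]
  simp only [eval_add, eval_smul, smul_eq_mul]
  push_cast
  simp only [pow_zero, Function.iterate_zero, id_eq, div_one, Module.End.one_apply] at h0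
  linarith

/-- The coefficient list of `2 * 9 ^ (n + 5) * (n + 5)! * ∑ i < n, termPoly i` for `n < 40`. -/
def accList : ℕ → List ℤ
  | 0 => []
  | n + 1 => listAdd (listSmul (9 * (n + 6)) (accList n))
      (listSmul ((-1) ^ n * tableDiff (n + 6)) (0 :: binList n))

theorem ofList_accList {n : ℕ} (hn : n < 40) :
    ofList (accList n) =
      (2 * 9 ^ (n + 5) * (n + 5).factorial : ℝ) • ∑ i ∈ Finset.range n, termPoly i := by
  induction n with
  | zero => simp [accList, ofList]
  | succ n ih =>
    rw [accList, ofList_listAdd, ofList_listSmul, ofList_listSmul, ofList_zero_cons,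
      ofList_binList, ih (by lia), Finset.sum_range_succ, smul_add, termPoly,
      momentDiff_eq_tableDiff (by lia), ← smul_eq_C_mul, ← smul_eq_C_mul, smul_smul, smul_smul]
    congr 2
    · rw [show n + 1 + 5 = n + 5 + 1 by ring, Nat.factorial_succ (n + 5)]
      push_cast
      ring
    · rw [show n + 1 + 5 = n + 6 by ring]
      push_cast
      field_simp

theorem lt_twistLowerBound :
    2 * 9 ^ 44 * (Nat.factorial 44 : ℚ) / 50000 <
      twistLowerBound (13 / 100) (3 / 500) (accList 39) := by
  decide +kernel

theorem lt_eval_sum_termPoly {τ : ℝ} (hτ : 0 ≤ τ) (hτr : τ ≤ 13 / 100) :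
    1 / 50000 < ∑ i ∈ Finset.range 39,
      ((twist (Real.log (9 / 2)) ^ 4) (termPoly i)).eval τ := by
  have h1 := (Rat.cast_lt (K := ℝ)).2 lt_twistLowerBound
  have hsum := ofList_accList (n := 39) (by norm_num)
  generalize accList 39 = l at h1 hsum
  have h2 := twistLowerBound_le_eval (r := 13 / 100) (δ := 3 / 500) (τ := τ)
    (θ := Real.log (9 / 2) - 188 / 125) (by norm_num) hτ (by simpa using hτr)
    (by linarith [le_log_nine_halves]) (by push_cast; linarith [log_nine_halves_le]) l
  rw [add_sub_cancel, hsum, map_smul, eval_smul, smul_eq_mul, map_sum, eval_finsetSum] at h2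
  have h3 := h1.trans_le h2
  simp only [Rat.cast_div, Rat.cast_mul, Rat.cast_pow, Rat.cast_natCast, Rat.cast_ofNat] at h3
  rw [div_eq_mul_one_div] at h3
  exact lt_of_mul_lt_mul_left h3 (by positivity)

end PartialSum

/-! ### The tail -/

section Tail

open Polynomial

theorem abs_eval_twist_pow_four_termPoly_le {τ : ℝ} (hτ : 0 ≤ τ) (hτr : τ ≤ 13 / 100) {n : ℕ}
    (hn : 39 ≤ n) :
    |((twist (Real.log (9 / 2)) ^ 4) (termPoly n)).eval τ| ≤
      236.88 / (((n : ℝ) + 1) * (n + 2) * (n + 3) * (n + 4) * (n + 5)) := by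
  obtain ⟨h8, h4⟩ := growthRate_pow_four_le hn
  have hlog := one_le_log_nine_halves
  have hb (j : ℕ) := abs_eval_twist_pow_binPoly_le_of_mem_Icc (c := Real.log (9 / 2))
    (by linarith) hτ hτr (by norm_num) n j
  set h := growthRate (Real.log (9 / 2)) n
  set q : ℝ := (5 + 13 / 100) * ((4 + 13 / 100) * ((3 + 13 / 100) * ((2 + 13 / 100) *
    (1 + 13 / 100)))) with hq
  have hq' : q ≤ 160 := by norm_num [hq]
  have hq0 : 0 ≤ q := by norm_num [hq]
  clear_value q h
  have hX : |((twist (Real.log (9 / 2)) ^ 4) (X * binPoly n)).eval τ| ≤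
      (13 / 100 + 1 / 2) * (n.factorial * q * (94 * (n + 6))) := by
    rw [eval_twist_pow_X_mul _ _ _ 3]
    have h1 : |τ * ((twist (Real.log (9 / 2)) ^ 4) (binPoly n)).eval τ| ≤
        13 / 100 * (n.factorial * q * h ^ 4) := by
      rw [abs_mul, abs_of_nonneg hτ]
      exact mul_le_mul hτr (hb 4) (abs_nonneg _) (by norm_num)
    have h2 : |((3 : ℕ) + 1 : ℝ) * ((twist (Real.log (9 / 2)) ^ 3) (binPoly n)).eval τ| ≤
        1 / 2 * (n.factorial * q * h ^ 4) := by
      rw [abs_mul, abs_of_nonneg (by positivity)]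
      have h3 : h ^ 3 * 8 ≤ h ^ 4 := by
        rw [pow_succ h 3]
        exact mul_le_mul_of_nonneg_left h8 (by positivity)
      have h5 := mul_le_mul_of_nonneg_left h3 (by positivity : 0 ≤ n.factorial * q)
      rw [Nat.cast_ofNat]
      linarith [hb 3]
    have h6 := mul_le_mul_of_nonneg_left h4 (by positivity : 0 ≤ n.factorial * q)
    refine (abs_add_le _ _).trans ((add_le_add h1 h2).trans ?_)
    linarith
  rw [abs_eval_twist_pow_termPoly]
  calc _ ≤ 1 / 40 * ((13 / 100 + 1 / 2) * ((n.factorial : ℝ) * 160 * (94 * (n + 6))) /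
        (n + 6).factorial) := by
        refine mul_le_mul (abs_momentDiff_le_of_le (by lia)) ?_ (by positivity) (by norm_num)
        refine div_le_div_of_nonneg_right (hX.trans ?_) (by positivity)
        gcongr
    _ = _ := by
        rw [factorial_add_six, Nat.factorial_succ]
        push_cast
        field_simp
        norm_num

theorem tsum_le_of_le_div {a : ℕ → ℝ} {c m : ℝ} (hc : 0 ≤ c) (hm : 0 < m)
    (ha : ∀ n, 0 ≤ a n)
    (h : ∀ n : ℕ, a n ≤ c / ((n + m) * (n + m + 1) * (n + m + 2) * (n + m + 3) * (n + m + 4))) :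
    ∑' n, a n ≤ c / (4 * (m * (m + 1) * (m + 2) * (m + 3))) := by
  refine Real.tsum_le_of_sum_range_le ha fun N => ?_
  have key : ∑ i ∈ Finset.range N, a i ≤ c / (4 * (m * (m + 1) * (m + 2) * (m + 3))) -
      c / (4 * ((N + m) * (N + m + 1) * (N + m + 2) * (N + m + 3))) := by
    induction N with
    | zero => simp
    | succ N ih =>
      rw [Finset.sum_range_succ]
      have hstep : c / ((N + m) * (N + m + 1) * (N + m + 2) * (N + m + 3) * (N + m + 4)) =
          c / (4 * ((N + m) * (N + m + 1) * (N + m + 2) * (N + m + 3))) -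
            c / (4 * (((N + 1 : ℕ) + m) * ((N + 1 : ℕ) + m + 1) * ((N + 1 : ℕ) + m + 2) *
              ((N + 1 : ℕ) + m + 3))) := by
        push_cast
        rw [show (N : ℝ) + 1 + m = N + m + 1 by ring]
        have hx : 0 < N + m := by positivity
        generalize (N : ℝ) + m = x at hx
        field_simp
        ring
      linarith [h N]
  refine key.trans (sub_le_self _ ?_)
  positivity

theorem abs_tsum_eval_termPoly_le {τ : ℝ} (hτ : 0 ≤ τ) (hτr : τ ≤ 13 / 100) :
    |∑' n, ((twist (Real.log (9 / 2)) ^ 4) (termPoly (n + 39))).eval τ| ≤ 1 / 50000 := by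
  have hs : Summable fun n =>
      |((twist (Real.log (9 / 2)) ^ 4) (termPoly (n + 39))).eval τ| :=
    ((summable_nat_add_iff 39).2 summable_termBound).of_nonneg_of_le (fun _ => abs_nonneg _)
      fun n => abs_eval_twist_pow_termPoly_le (abs_le.2 ⟨by linarith, by linarith⟩) _ le_rfl
  have hb (n : ℕ) : |((twist (Real.log (9 / 2)) ^ 4) (termPoly (n + 39))).eval τ| ≤
      236.88 / (((n : ℝ) + 40) * (n + 40 + 1) * (n + 40 + 2) * (n + 40 + 3) * (n + 40 + 4)) := by
    have h := abs_eval_twist_pow_four_termPoly_le hτ hτr (Nat.le_add_left 39 n)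
    rw [Nat.cast_add, Nat.cast_ofNat] at h
    refine h.trans_eq ?_
    ring
  have hsum := tsum_le_of_le_div (by norm_num) (by norm_num) (fun n => abs_nonneg _) hb
  simp only [← Real.norm_eq_abs] at hs hsum ⊢
  refine (norm_tsum_le_tsum_norm hs).trans (hsum.trans ?_)
  norm_num

end Tail

theorem stmt12 : ∀ t : ℝ, 5 ≤ t → t ≤ 5.13 → 0 < iteratedDeriv 4 d t := by
  intro t ht5 ht
  have hτ : 0 ≤ t - 5 := sub_nonneg.2 ht5
  have hτr : t - 5 ≤ 13 / 100 := by linarith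
  rw [iteratedDeriv_d le_rfl ⟨by linarith, by linarith⟩, tsum_mul_left]
  refine mul_pos (by positivity) ?_
  have hs : Summable fun n => ((twist (Real.log (9 / 2)) ^ 4) (termPoly n)).eval (t - 5) :=
    .of_norm_bounded summable_termBound fun n =>
      abs_eval_twist_pow_termPoly_le (abs_le.2 ⟨by linarith, by linarith⟩) n le_rfl
  rw [← hs.sum_add_tsum_nat_add 39]
  linarith [lt_eval_sum_termPoly hτ hτr, (abs_le.1 (abs_tsum_eval_termPoly_le hτ hτr)).1]
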